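/- Let p = (p_1,…,p_d) be a non-uniform probability distribution with all p_i > 0, and let A ∈ ℝ. Define P_{n,1/2}(R) = Σ { √(P^n(x⃗)) : x⃗ ∈ {1,…,d}^n, log P^n(x⃗) ≥ nR }. Then there exist a constant C and an integer N such that for all n ≥ N, | log P_{n,1/2}( −H(p) + A/√n ) − ( n·H(p)/2 − √n·A/2 − (1/2)·log n ) | ≤ C. -/

import Mathlib

open scoped BigOperators Classical
open Real

/-- Shannon entropy (natural log). -/
noncomputable def shannonH {d : ℕ} (p : Fin d → ℝ) : ℝ :=
  -∑ i, p i * Real.log (p i)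

/-- Product probability `P^n(x)` of a string. -/
noncomputable def prodP {d : ℕ} (p : Fin d → ℝ) {n : ℕ} (x : Fin n → Fin d) : ℝ :=
  ∏ k, p (x k)

/-- The superlevel set `S_n(R) = {x : log P^n(x) ≥ nR}`. -/
noncomputable def SnSet (d : ℕ) (p : Fin d → ℝ) (n : ℕ) (R : ℝ) : Finset (Fin n → Fin d) :=
  Finset.univ.filter (fun x => (n : ℝ) * R ≤ Real.log (prodP p x))

/-- `P_{n,1/2}(R) = Σ_{x ∈ S_n(R)} √(P^n(x))`. -/
noncomputable def PnHalf (d : ℕ) (p : Fin d → ℝ) (n : ℕ) (R : ℝ) : ℝ :=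
  ∑ x ∈ SnSet d p n R, Real.sqrt (prodP p x)

/-- The characteristic function of the distribution giving mass `p i` to the value `X i`. -/
noncomputable def discreteCharFun {d : ℕ} (p X : Fin d → ℝ) (θ : ℝ) : ℂ :=
  ∑ i, (p i : ℂ) * Complex.exp (θ * X i * Complex.I)

theorem sum_prodP_mul_cos {d : ℕ} (p X : Fin d → ℝ) (n : ℕ) (θ b : ℝ) :
    ∑ x : Fin n → Fin d, prodP p x * Real.cos (θ * (∑ k, X (x k) - b)) =
      (Complex.exp (-(θ * b) * Complex.I) *
        discreteCharFun p X θ ^ n).re := by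
  unfold discreteCharFun
  have h : (∑ i, (p i : ℂ) * Complex.exp (θ * X i * Complex.I)) ^ n =
      ∑ x : Fin n → Fin d, ∏ k, ((p (x k) : ℂ) * Complex.exp (θ * X (x k) * Complex.I)) := by
    have := (Finset.prod_univ_sum (fun _ : Fin n => (Finset.univ : Finset (Fin d)))
      (fun _ i => (p i : ℂ) * Complex.exp (θ * X i * Complex.I)))
    simpa using this
  rw [h, Finset.mul_sum, Complex.re_sum]
  refine Finset.sum_congr rfl fun x _ => ?_
  rw [Finset.prod_mul_distrib, ← Complex.exp_sum, mul_left_comm, ← Complex.exp_add]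
  have e : -((θ : ℂ) * b) * Complex.I + ∑ k, (θ : ℂ) * X (x k) * Complex.I =
      ((θ * (∑ k, X (x k) - b) : ℝ) : ℂ) * Complex.I := by
    push_cast
    rw [← Finset.sum_mul, ← Finset.mul_sum]; ring
  rw [e, ← Complex.ofReal_prod, Complex.re_ofReal_mul, Complex.exp_ofReal_mul_I_re]
  rfl

theorem exists_norm_discreteCharFun_le_exp {d : ℕ} (p X : Fin d → ℝ) (hpos : ∀ i, 0 < p i)
    (hsum : ∑ i, p i = 1)
    (hX : ∃ i j, X i ≠ X j) :
    ∃ δ : ℝ, 0 < δ ∧ ∃ c : ℝ, 0 < c ∧ ∀ θ : ℝ, |θ| ≤ δ →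
      ‖discreteCharFun p X θ‖ ≤ Real.exp (-c * θ ^ 2) := by
  unfold discreteCharFun
  obtain ⟨i, j, hij⟩ := hX
  have hD : 0 < |X i - X j| := abs_pos.2 (sub_ne_zero.2 hij)
  refine ⟨π / |X i - X j|, by positivity, p i * p j * (X i - X j) ^ 2 / π ^ 2, ?_, ?_⟩
  · have := hpos i; have := hpos j
    have : 0 < (X i - X j) ^ 2 := by simpa using pow_pos hD 2
    positivity
  intro θ hθ
  have hv : |θ * (X i - X j)| ≤ π := by
    rw [abs_mul]; exact (le_div_iff₀ hD).1 hθ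
  have hc := Real.cos_le_one_sub_mul_cos_sq hv
  have hsq : ‖∑ i, (p i : ℂ) * Complex.exp (θ * X i * Complex.I)‖ ^ 2 =
      ∑ a, ∑ b, p a * p b * Real.cos (θ * (X a - X b)) := by
    have hre : (∑ i, (p i : ℂ) * Complex.exp (θ * X i * Complex.I)).re =
        ∑ i, p i * Real.cos (θ * X i) := by
      rw [Complex.re_sum]
      refine Finset.sum_congr rfl fun a _ => ?_
      rw [Complex.re_ofReal_mul, ← Complex.ofReal_mul, Complex.exp_ofReal_mul_I_re]
    have him : (∑ i, (p i : ℂ) * Complex.exp (θ * X i * Complex.I)).im =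
        ∑ i, p i * Real.sin (θ * X i) := by
      rw [Complex.im_sum]
      refine Finset.sum_congr rfl fun a _ => ?_
      rw [Complex.im_ofReal_mul, ← Complex.ofReal_mul, Complex.exp_ofReal_mul_I_im]
    rw [← Complex.normSq_eq_norm_sq, Complex.normSq_apply, hre, him, Finset.sum_mul_sum,
      Finset.sum_mul_sum, ← Finset.sum_add_distrib]
    refine Finset.sum_congr rfl fun a _ => ?_
    rw [← Finset.sum_add_distrib]
    refine Finset.sum_congr rfl fun b _ => ?_
    rw [mul_sub, Real.cos_sub]; ring
  have hone : ∑ a, ∑ b, p a * p b = 1 := by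
    rw [← Finset.sum_mul_sum, hsum, one_mul]
  have hdiff : p i * p j * (1 - Real.cos (θ * (X i - X j))) ≤
      ∑ a, ∑ b, p a * p b * (1 - Real.cos (θ * (X a - X b))) := by
    have nn : ∀ a b, 0 ≤ p a * p b * (1 - Real.cos (θ * (X a - X b))) := fun a b =>
      mul_nonneg (mul_nonneg (hpos a).le (hpos b).le) (sub_nonneg.2 (Real.cos_le_one _))
    refine le_trans ?_ (Finset.single_le_sum (fun a _ => Finset.sum_nonneg fun b _ => nn a b)
      (Finset.mem_univ i))
    exact Finset.single_le_sum (fun b _ => nn i b) (Finset.mem_univ j)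
  have hexp : ∑ a, ∑ b, p a * p b * (1 - Real.cos (θ * (X a - X b))) =
      1 - ∑ a, ∑ b, p a * p b * Real.cos (θ * (X a - X b)) := by
    simp only [mul_sub, mul_one, Finset.sum_sub_distrib, hone]
  have hpp : 0 < p i * p j := mul_pos (hpos i) (hpos j)
  have key : ‖∑ i, (p i : ℂ) * Complex.exp (θ * X i * Complex.I)‖ ^ 2 ≤
      1 + 2 * (-(p i * p j * (X i - X j) ^ 2 / π ^ 2) * θ ^ 2) := by
    rw [hsq]
    have h2 : p i * p j * (2 / π ^ 2 * (θ * (X i - X j)) ^ 2) ≤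
        p i * p j * (1 - Real.cos (θ * (X i - X j))) :=
      mul_le_mul_of_nonneg_left (by linarith) hpp.le
    have h3 : p i * p j * (2 / π ^ 2 * (θ * (X i - X j)) ^ 2) =
      -(2 * (-(p i * p j * (X i - X j) ^ 2 / π ^ 2) * θ ^ 2)) := by ring
    linarith
  refine abs_le_of_sq_le_sq' ?_ (Real.exp_pos _).le |>.2
  refine key.trans ?_
  rw [← Real.exp_nat_mul]
  push_cast
  linarith [Real.add_one_le_exp (2 * (-(p i * p j * (X i - X j) ^ 2 / π ^ 2) * θ ^ 2))]

theorem integral_fejer_mul_cos_nonneg (s : ℝ) : 0 ≤ ∫ t in (0 : ℝ)..1, (1 - t) * Real.cos (t * s) := by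
  by_cases hs : s = 0
  · subst hs
    refine intervalIntegral.integral_nonneg zero_le_one fun t ht => ?_
    simpa using ht.2
  have hd : ∀ t ∈ Set.uIcc (0 : ℝ) 1, HasDerivAt
      (fun t => (1 - t) * Real.sin (t * s) / s - Real.cos (t * s) / s ^ 2)
      ((1 - t) * Real.cos (t * s)) t := by
    intro t _
    have h1 : HasDerivAt (fun t : ℝ => t * s) s t := by simpa using (hasDerivAt_id t).mul_const s
    have h2 : HasDerivAt (fun t : ℝ => 1 - t) (-1) t := by simpa using (hasDerivAt_id t).const_sub 1
    refine (((h2.mul h1.sin).div_const s).sub (h1.cos.div_const (s ^ 2))).congr_deriv ?_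
    field_simp
    ring
  rw [intervalIntegral.integral_eq_sub_of_hasDerivAt hd
    (Continuous.intervalIntegrable (by fun_prop) _ _)]
  have := Real.cos_le_one s
  have h : (0 : ℝ) < s ^ 2 := by positivity
  have := div_le_div_of_nonneg_right this h.le
  simp only [one_div] at this
  simp
  linarith

theorem one_fourth_le_integral_fejer_mul_cos (s : ℝ) (hs : |s| ≤ 1) :
    1 / 4 ≤ ∫ t in (0 : ℝ)..1, (1 - t) * Real.cos (t * s) := by
  have h : ∫ t in (0 : ℝ)..1, (1 - t) * (1 / 2) = 1 / 4 := by
    rw [intervalIntegral.integral_mul_const, intervalIntegral.integral_sub (by simp) (by simp)]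
    simp
    norm_num
  rw [← h]
  refine intervalIntegral.integral_mono_on zero_le_one
    (Continuous.intervalIntegrable (by fun_prop) _ _)
    (Continuous.intervalIntegrable (by fun_prop) _ _) fun t ht => ?_
  refine mul_le_mul_of_nonneg_left ?_ (by linarith [ht.2])
  have : |t * s| ≤ 1 := by
    rw [abs_mul, abs_of_nonneg ht.1]; exact mul_le_one₀ ht.2 (abs_nonneg _) hs
  have h2 := Real.one_sub_sq_div_two_le_cos (x := t * s)
  have : (t * s) ^ 2 ≤ 1 := (sq_le_one_iff_abs_le_one _).2 this
  linarith

/-- The kernel `(1 - t) cos (π t) + sin (π t)` equals one at the origin, while its cosine transform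
is nonpositive away from a bounded interval; it detects mass in a window of constant length. -/
theorem integral_minorant_mul_cos_nonpos (s : ℝ) (hs : 5 ≤ |s|) :
    ∫ t in (0 : ℝ)..1, ((1 - t) * Real.cos (π * t) + Real.sin (π * t)) * Real.cos (t * s) ≤ 0 := by
  have hp := Real.pi_gt_three
  have hp' := Real.pi_lt_d2
  have hs2 : 25 ≤ s ^ 2 := by
    have : 5 ^ 2 ≤ |s| ^ 2 := by gcongr
    rw [sq_abs] at this; linarith
  have hu : π + s ≠ 0 := fun h => by nlinarith [show s = -π by linarith]
  have hv : π - s ≠ 0 := fun h => by nlinarith [show s = π by linarith]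
  have hd : ∀ t ∈ Set.uIcc (0 : ℝ) 1, HasDerivAt
      (fun t => (((1 - t) * Real.sin ((π + s) * t) / (π + s) - Real.cos ((π + s) * t) / (π + s) ^ 2
        - Real.cos ((π + s) * t) / (π + s)) +
        ((1 - t) * Real.sin ((π - s) * t) / (π - s) - Real.cos ((π - s) * t) / (π - s) ^ 2
        - Real.cos ((π - s) * t) / (π - s))) / 2)
      (((1 - t) * Real.cos (π * t) + Real.sin (π * t)) * Real.cos (t * s)) t := by
    intro t _
    have h1 : ∀ w : ℝ, HasDerivAt (fun t : ℝ => w * t) w t := fun w => by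
      simpa using (hasDerivAt_id t).const_mul w
    have h2 : HasDerivAt (fun t : ℝ => 1 - t) (-1) t := by simpa using (hasDerivAt_id t).const_sub 1
    have h3 : ∀ w : ℝ, w ≠ 0 → HasDerivAt (fun t : ℝ => (1 - t) * Real.sin (w * t) / w -
        Real.cos (w * t) / w ^ 2 - Real.cos (w * t) / w)
        ((1 - t) * Real.cos (w * t) + Real.sin (w * t)) t := fun w hw => by
      refine ((((h2.mul (h1 w).sin).div_const w).sub ((h1 w).cos.div_const (w ^ 2))).sub
        ((h1 w).cos.div_const w)).congr_deriv ?_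
      field_simp
      ring
    refine (((h3 _ hu).add (h3 _ hv)).div_const 2).congr_deriv ?_
    rw [add_mul π s, sub_mul π s, Real.cos_add, Real.sin_add, Real.cos_sub, Real.sin_sub, mul_comm s t]
    ring
  rw [intervalIntegral.integral_eq_sub_of_hasDerivAt hd
    (Continuous.intervalIntegrable (by fun_prop) _ _)]
  have hc : 0 ≤ 1 + Real.cos s := by linarith [Real.neg_one_le_cos s]
  have e : (1 + Real.cos s) * (((π ^ 2 + s ^ 2) + π * (π ^ 2 - s ^ 2)) / ((π + s) ^ 2 * (π - s) ^ 2)) ≤ 0 := by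
    refine mul_nonpos_of_nonneg_of_nonpos hc (div_nonpos_of_nonpos_of_nonneg ?_ (by positivity))
    nlinarith
  refine le_of_eq_of_le ?_ e
  simp [Real.cos_add, Real.cos_sub]
  field_simp
  ring

open MeasureTheory Filter Topology

theorem integral_cos_mul_gaussian_pos (α β : ℝ) (hα : 0 < α) :
    0 < ∫ u in Set.Ioi (0 : ℝ), Real.cos (β * u) * Real.exp (-α * u ^ 2) := by
  have h := @integral_comp_abs (fun u => Real.cos (β * u) * Real.exp (-α * u ^ 2))
  have e : ∀ u : ℝ, Real.cos (β * |u|) * Real.exp (-α * |u| ^ 2) =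
      (Complex.exp (Complex.I * β * u) * Complex.exp (-(α : ℂ) * u ^ 2)).re := by
    intro u
    have h1 : Complex.exp (Complex.I * β * u) = Complex.exp ((β * u : ℝ) * Complex.I) := by
      congr 1; push_cast; ring
    have h2 : Complex.exp (-(α : ℂ) * u ^ 2) = (Real.exp (-α * u ^ 2) : ℝ) := by
      push_cast; rfl
    rw [h1, h2, Complex.re_mul_ofReal, Complex.exp_ofReal_mul_I_re, sq_abs]
    congr 1
    rcases abs_cases u with ⟨h, _⟩ | ⟨h, _⟩ <;> rw [h]
    rw [mul_neg, Real.cos_neg]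
  have hg := fourierIntegral_gaussian (b := (α : ℂ)) (by simpa using hα) β
  have hint : Integrable fun u : ℝ =>
      Complex.exp (Complex.I * β * u) * Complex.exp (-(α : ℂ) * u ^ 2) := by
    refine (integrable_exp_neg_mul_sq hα).mono' (by fun_prop) (ae_of_all _ fun u => ?_)
    have h1 : Complex.exp (Complex.I * β * u) = Complex.exp ((β * u : ℝ) * Complex.I) := by
      congr 1; push_cast; ring
    have h2 : Complex.exp (-(α : ℂ) * u ^ 2) = (Real.exp (-α * u ^ 2) : ℝ) := by
      push_cast; rfl
    rw [norm_mul, h1, Complex.norm_exp_ofReal_mul_I, h2, Complex.norm_real, one_mul,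
      Real.norm_of_nonneg (Real.exp_pos _).le]
  have hre : ∫ u : ℝ, (Complex.exp (Complex.I * β * u) * Complex.exp (-(α : ℂ) * u ^ 2)).re =
      Real.sqrt (π / α) * Real.exp (-β ^ 2 / (4 * α)) := by
    have := integral_re hint
    simp only [RCLike.re_eq_complex_re] at this
    rw [this, hg]
    have h1 : ((π : ℂ) / α) ^ (1 / 2 : ℂ) = (Real.sqrt (π / α) : ℝ) := by
      rw [Real.sqrt_eq_rpow, Complex.ofReal_cpow (by positivity)]
      push_cast; rfl
    have h2 : Complex.exp (-(β : ℂ) ^ 2 / (4 * α)) = (Real.exp (-β ^ 2 / (4 * α)) : ℝ) := by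
      push_cast; rfl
    rw [h1, h2, ← Complex.ofReal_mul, Complex.ofReal_re]
  simp_rw [e] at h
  rw [hre] at h
  have : 0 < Real.sqrt (π / α) * Real.exp (-β ^ 2 / (4 * α)) := by positivity
  linarith

theorem tendsto_nat_mul_exp_sub_one_sub (z : ℂ) :
    Tendsto (fun n : ℕ => (n : ℂ) * (Complex.exp (z / (√n : ℝ)) - 1 - z / (√n : ℝ)))
      atTop (𝓝 (z ^ 2 / 2)) := by
  rw [tendsto_iff_norm_sub_tendsto_zero]
  have hs : Tendsto (fun n : ℕ => √(n : ℝ)) atTop atTop :=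
    Real.tendsto_sqrt_atTop.comp tendsto_natCast_atTop_atTop
  have hlim : Tendsto (fun n : ℕ => ‖z‖ ^ 3 * Real.exp ‖z‖ / √(n : ℝ)) atTop (𝓝 0) :=
    hs.const_div_atTop _
  refine squeeze_zero' (Eventually.of_forall fun _ => norm_nonneg _) ?_ hlim
  filter_upwards [eventually_ge_atTop 1] with n hn
  have hn1 : (1 : ℝ) ≤ n := by exact_mod_cast hn
  have hs1 : 1 ≤ √(n : ℝ) := Real.one_le_sqrt.2 hn1
  have hs0 : 0 < √(n : ℝ) := by linarith
  have hsq : √(n : ℝ) ^ 2 = n := Real.sq_sqrt (by linarith)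
  have hsqc : ((√(n : ℝ) : ℝ) : ℂ) ^ 2 = n := by rw [← Complex.ofReal_pow, hsq]; simp
  have hsc : ((√(n : ℝ) : ℝ) : ℂ) ≠ 0 := Complex.ofReal_ne_zero.2 hs0.ne'
  have e : (n : ℂ) * (Complex.exp (z / (√n : ℝ)) - 1 - z / (√n : ℝ)) - z ^ 2 / 2 =
      n * (Complex.exp (z / (√n : ℝ)) -
        ∑ m ∈ Finset.range 3, (z / (√n : ℝ)) ^ m / m.factorial) := by
    simp only [Finset.sum_range_succ, Finset.sum_range_zero]
    rw [← hsqc]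
    simp [Nat.factorial]
    field_simp
    ring
  have hnorm : ‖z / ((√n : ℝ) : ℂ)‖ = ‖z‖ / √n := by
    rw [norm_div, Complex.norm_real, Real.norm_of_nonneg hs0.le]
  have hb := Complex.norm_exp_sub_sum_le_norm_mul_exp (z / ((√n : ℝ) : ℂ)) 3
  rw [hnorm] at hb
  rw [e, norm_mul, Complex.norm_natCast]
  calc (n : ℝ) * _ ≤ n * ((‖z‖ / √n) ^ 3 * Real.exp (‖z‖ / √n)) := by gcongr
    _ ≤ n * ((‖z‖ / √n) ^ 3 * Real.exp ‖z‖) := by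
      gcongr
      exact div_le_self (norm_nonneg _) hs1
    _ = ‖z‖ ^ 3 * Real.exp ‖z‖ / √n := by
      rw [← hsq]
      field_simp
      simp only [hsq]
      ring

theorem tendsto_discreteCharFun_div_sqrt_pow {d : ℕ} (p X : Fin d → ℝ) (hsum : ∑ i, p i = 1)
    (hmean : ∑ i, p i * X i = 0) (v : ℝ) :
    Tendsto (fun n : ℕ => discreteCharFun p X (v / √n) ^ n) atTop
      (𝓝 (Complex.exp ((-((∑ i, p i * X i ^ 2) / 2 * v ^ 2) : ℝ) : ℂ))) := by
  have h := tendsto_finsetSum Finset.univ fun i _ =>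
    (tendsto_nat_mul_exp_sub_one_sub (v * X i * Complex.I)).const_mul (p i : ℂ)
  have e : ∑ i, (p i : ℂ) * ((v * X i * Complex.I) ^ 2 / 2) =
      ((-((∑ i, p i * X i ^ 2) / 2 * v ^ 2) : ℝ) : ℂ) := by
    push_cast
    rw [Finset.sum_div, Finset.sum_mul, ← Finset.sum_neg_distrib]
    refine Finset.sum_congr rfl fun i _ => ?_
    rw [mul_pow, Complex.I_sq]; ring
  rw [e] at h
  have h' : Tendsto (fun n : ℕ => (n : ℂ) * (discreteCharFun p X (v / √n) - 1)) atTop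
      (𝓝 ((-((∑ i, p i * X i ^ 2) / 2 * v ^ 2) : ℝ) : ℂ)) := by
    refine h.congr fun n => ?_
    have hs : ∑ i, (p i : ℂ) = 1 := by exact_mod_cast hsum
    have hm : ∑ i, (p i : ℂ) * X i = 0 := by exact_mod_cast hmean
    have e1 : ∀ i, (p i : ℂ) * ((n : ℂ) * (Complex.exp (v * X i * Complex.I / (√n : ℝ)) - 1 -
        v * X i * Complex.I / (√n : ℝ))) =
        n * ((p i : ℂ) * Complex.exp ((v / √n : ℝ) * X i * Complex.I)) - n * p i -
          (n * v * Complex.I / (√n : ℝ)) * ((p i : ℂ) * X i) := fun i => by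
      have : (v : ℂ) * X i * Complex.I / (√n : ℝ) = (v / √n : ℝ) * X i * Complex.I := by
        push_cast; ring
      rw [this]; push_cast; ring
    simp_rw [e1]
    rw [Finset.sum_sub_distrib, Finset.sum_sub_distrib, ← Finset.mul_sum, ← Finset.mul_sum,
      ← Finset.mul_sum, hs, hm, discreteCharFun]
    ring
  simpa using Complex.tendsto_one_add_pow_exp_of_tendsto h'

theorem continuous_discreteCharFun {d : ℕ} (p X : Fin d → ℝ) :
    Continuous (discreteCharFun p X) := by
  unfold discreteCharFun; fun_prop

theorem sum_prodP_mul_integral {d : ℕ} (p X : Fin d → ℝ) (n : ℕ) (δ b : ℝ) {k : ℝ → ℝ}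
    (hk : Continuous k) :
    ∑ x : Fin n → Fin d, prodP p x *
        ∫ t in (0 : ℝ)..1, k t * Real.cos (t * (δ * (∑ j, X (x j) - b))) =
      ∫ t in (0 : ℝ)..1, k t * (Complex.exp (-((t * δ : ℝ) * b) * Complex.I) *
        discreteCharFun p X (t * δ) ^ n).re := by
  simp_rw [← sum_prodP_mul_cos, ← intervalIntegral.integral_const_mul]
  rw [← intervalIntegral.integral_finsetSum
    fun x _ => Continuous.intervalIntegrable (by fun_prop) _ _]
  refine intervalIntegral.integral_congr fun t _ => ?_
  simp only [Finset.mul_sum]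
  refine Finset.sum_congr rfl fun x _ => ?_
  rw [← mul_assoc t δ]; ring

theorem prodP_nonneg {d : ℕ} {p : Fin d → ℝ} (hpos : ∀ i, 0 < p i) {n : ℕ} (x : Fin n → Fin d) :
    0 ≤ prodP p x := Finset.prod_nonneg fun _ _ => (hpos _).le

theorem abs_re_exp_mul_discreteCharFun_pow_le {d : ℕ} {p X : Fin d → ℝ} {c θ : ℝ}
    (h : ‖discreteCharFun p X θ‖ ≤ Real.exp (-c * θ ^ 2)) (b : ℝ) (n : ℕ) :
    |(Complex.exp (-(θ * b) * Complex.I) * discreteCharFun p X θ ^ n).re| ≤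
      Real.exp (-(c * n) * θ ^ 2) := by
  refine (Complex.abs_re_le_norm _).trans ?_
  have : -((θ : ℂ) * b) = ((-(θ * b) : ℝ) : ℂ) := by push_cast; rfl
  rw [norm_mul, this, Complex.norm_exp_ofReal_mul_I, one_mul, norm_pow]
  refine (pow_le_pow_left₀ (norm_nonneg _) h n).trans_eq ?_
  rw [← Real.exp_nat_mul]; congr 1; ring

theorem exists_sum_window_le_div_sqrt {d : ℕ} (p X : Fin d → ℝ) (hpos : ∀ i, 0 < p i)
    (hsum : ∑ i, p i = 1)
    (hX : ∃ i j, X i ≠ X j) :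
    ∃ w : ℝ, 0 < w ∧ ∃ K : ℝ, 0 < K ∧ ∀ n : ℕ, 1 ≤ n → ∀ a : ℝ,
      ∑ x : Fin n → Fin d with a ≤ ∑ j, X (x j) ∧ ∑ j, X (x j) < a + w, prodP p x ≤ K / √n := by
  obtain ⟨δ, hδ, c, hc, hψ⟩ := exists_norm_discreteCharFun_le_exp p X hpos hsum hX
  refine ⟨1 / δ, by positivity, 4 * (√(π / (c * δ ^ 2)) / 2), by positivity, fun n hn a => ?_⟩
  have hn0 : (0 : ℝ) < n := by exact_mod_cast hn
  have h1 : ∑ x : Fin n → Fin d with a ≤ ∑ j, X (x j) ∧ ∑ j, X (x j) < a + 1 / δ,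
      prodP p x * (1 / 4) ≤ ∑ x : Fin n → Fin d, prodP p x *
        ∫ t in (0 : ℝ)..1, (1 - t) * Real.cos (t * (δ * (∑ j, X (x j) - a))) := by
    rw [Finset.sum_filter]
    refine Finset.sum_le_sum fun x _ => ?_
    split_ifs with hx
    · refine mul_le_mul_of_nonneg_left (one_fourth_le_integral_fejer_mul_cos _ ?_) (prodP_nonneg hpos x)
      rw [abs_mul, abs_of_pos hδ, abs_of_nonneg (by linarith), ← le_div_iff₀' hδ]
      linarith
    · exact mul_nonneg (prodP_nonneg hpos x) (integral_fejer_mul_cos_nonneg _)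
  rw [sum_prodP_mul_integral p X n δ a (by fun_prop), ← Finset.sum_mul] at h1
  have hcont := continuous_discreteCharFun p X
  have h2 : ∫ t in (0 : ℝ)..1, (1 - t) * (Complex.exp (-((t * δ : ℝ) * a) * Complex.I) *
        discreteCharFun p X (t * δ) ^ n).re ≤
      ∫ t in (0 : ℝ)..1, Real.exp (-(c * n * δ ^ 2) * t ^ 2) := by
    refine intervalIntegral.integral_mono_on zero_le_one
      (Continuous.intervalIntegrable (by fun_prop) _ _)
      (Continuous.intervalIntegrable (by fun_prop) _ _) fun t ht => ?_
    have hθ : |t * δ| ≤ δ := by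
      rw [abs_of_nonneg (mul_nonneg ht.1 hδ.le)]; exact mul_le_of_le_one_left hδ.le ht.2
    have h := abs_re_exp_mul_discreteCharFun_pow_le (hψ _ hθ) a n
    have e : Real.exp (-(c * n) * (t * δ) ^ 2) = Real.exp (-(c * n * δ ^ 2) * t ^ 2) := by
      congr 1; ring
    rw [e] at h
    refine (le_abs_self _).trans ?_
    rw [abs_mul, abs_of_nonneg (by linarith [ht.2] : 0 ≤ 1 - t)]
    refine (mul_le_of_le_one_left (abs_nonneg _) (by linarith [ht.1])).trans h
  have h3 : ∫ t in (0 : ℝ)..1, Real.exp (-(c * n * δ ^ 2) * t ^ 2) ≤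
      √(π / (c * n * δ ^ 2)) / 2 := by
    rw [← integral_gaussian_Ioi, intervalIntegral.integral_of_le zero_le_one]
    exact setIntegral_mono_set (integrable_exp_neg_mul_sq (by positivity)).integrableOn
      (ae_of_all _ fun _ => (Real.exp_pos _).le) (Set.Ioc_subset_Ioi_self.eventuallyLE)
  have h4 : √(π / (c * n * δ ^ 2)) = √(π / (c * δ ^ 2)) / √n := by
    rw [← Real.sqrt_div (by positivity)]; congr 1; field_simp
  rw [h4] at h3
  have : 4 * (√(π / (c * δ ^ 2)) / 2) / √n = 4 * (√(π / (c * δ ^ 2)) / √n / 2) := by ring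
  linarith

theorem exists_div_sqrt_le_sum_window {d : ℕ} (p X : Fin d → ℝ) (hpos : ∀ i, 0 < p i)
    (hsum : ∑ i, p i = 1)
    (hmean : ∑ i, p i * X i = 0) (hX : ∃ i j, X i ≠ X j) (A : ℝ) :
    ∃ L : ℝ, 0 < L ∧ ∃ K : ℝ, 0 < K ∧ ∃ N : ℕ, ∀ n : ℕ, N ≤ n →
      K / √n ≤ ∑ x : Fin n → Fin d with
        A * √n ≤ ∑ j, X (x j) ∧ ∑ j, X (x j) ≤ A * √n + L, prodP p x := by
  obtain ⟨δ, hδ, c, hc, hψ⟩ := exists_norm_discreteCharFun_le_exp p X hpos hsum hX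
  have hσ : 0 < ∑ i, p i * X i ^ 2 := by
    have nn : ∀ i, 0 ≤ p i * X i ^ 2 := fun i => mul_nonneg (hpos i).le (sq_nonneg _)
    refine (Finset.sum_nonneg fun i _ => nn i).lt_of_ne' fun h => ?_
    have hz := (Finset.sum_eq_zero_iff_of_nonneg fun i _ => nn i).1 h
    have hX0 : ∀ i, X i = 0 := fun i => by
      simpa [(hpos i).ne'] using hz i (Finset.mem_univ i)
    obtain ⟨i, j, hij⟩ := hX
    exact hij (by rw [hX0, hX0])
  set σ2 := ∑ i, p i * X i ^ 2 with hσ2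
  have hcont := continuous_discreteCharFun p X
  let k : ℝ → ℝ := fun t => (1 - t) * Real.cos (π * t) + Real.sin (π * t)
  have hk : Continuous k := by fun_prop
  have hk2 : ∀ t ∈ Set.Icc (0 : ℝ) 1, |k t| ≤ 2 := fun t ht => by
    refine (abs_add_le _ _).trans ?_
    rw [abs_mul, abs_of_nonneg (by linarith [ht.2] : 0 ≤ 1 - t)]
    have h1 := Real.abs_cos_le_one (π * t)
    have h2 := Real.abs_sin_le_one (π * t)
    have := mul_le_one₀ (by linarith [ht.1] : 1 - t ≤ 1) (abs_nonneg _) h1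
    linarith
  let b : ℕ → ℝ := fun n => A * √n + 5 / δ
  let Φ : ℕ → ℝ → ℝ := fun n t => k t * (Complex.exp (-((t * δ : ℝ) * (b n : ℝ)) * Complex.I) *
        discreteCharFun p X (t * δ) ^ n).re
  have hΦc : ∀ n, Continuous (Φ n) := fun n => by fun_prop
  have hupper : ∀ n : ℕ, ∫ t in (0 : ℝ)..1, Φ n t ≤ 2 * ∑ x : Fin n → Fin d with
        A * √n ≤ ∑ j, X (x j) ∧ ∑ j, X (x j) ≤ A * √n + 10 / δ, prodP p x := fun n => by
    rw [← sum_prodP_mul_integral p X n δ (b n) hk, Finset.sum_filter, Finset.mul_sum]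
    refine Finset.sum_le_sum fun x _ => ?_
    split_ifs with hx
    · rw [mul_comm 2]
      refine mul_le_mul_of_nonneg_left ?_ (prodP_nonneg hpos x)
      refine (le_abs_self _).trans ?_
      have := intervalIntegral.norm_integral_le_of_norm_le_const (a := 0) (b := 1) (C := 2)
        (f := fun t => k t * Real.cos (t * (δ * (∑ j, X (x j) - b n)))) fun t ht => by
          rw [Set.uIoc_of_le zero_le_one] at ht
          rw [norm_mul, Real.norm_eq_abs, Real.norm_eq_abs]
          exact (mul_le_of_le_one_right (abs_nonneg _) (Real.abs_cos_le_one _)).trans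
            (hk2 t ⟨ht.1.le, ht.2⟩)
      simpa using this
    · rw [mul_zero]
      refine mul_nonpos_of_nonneg_of_nonpos (prodP_nonneg hpos x) (integral_minorant_mul_cos_nonpos _ ?_)
      by_contra! hlt
      rw [abs_mul, abs_of_pos hδ, ← lt_div_iff₀' hδ, abs_lt] at hlt
      have : 10 / δ = 5 / δ + 5 / δ := by ring
      refine hx ⟨?_, ?_⟩ <;> simp only [b] at hlt <;> linarith [hlt.1, hlt.2]
  let F : ℕ → ℝ → ℝ := fun n => Set.indicator (Set.Ioc 0 √n) fun u => Φ n (u / √n)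
  have hF : ∀ n : ℕ, 1 ≤ n → √n * ∫ t in (0 : ℝ)..1, Φ n t = ∫ u in Set.Ioi (0 : ℝ), F n u := by
    intro n hn
    have hs : 0 < √(n : ℝ) := Real.sqrt_pos.2 (by exact_mod_cast hn)
    have h := intervalIntegral.integral_comp_div (a := 0) (b := √n) (Φ n) hs.ne'
    rw [zero_div, div_self hs.ne', smul_eq_mul] at h
    rw [← h, intervalIntegral.integral_of_le hs.le,
      setIntegral_indicator measurableSet_Ioc, Set.inter_eq_self_of_subset_right
        Set.Ioc_subset_Ioi_self]
  have hlim : Tendsto (fun n => ∫ u in Set.Ioi (0 : ℝ), F n u) atTop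
      (𝓝 (∫ u in Set.Ioi (0 : ℝ), Real.cos (δ * A * u) * Real.exp (-(σ2 / 2 * δ ^ 2) * u ^ 2))) := by
    refine tendsto_integral_of_dominated_convergence
      (fun u => 2 * Real.exp (-(c * δ ^ 2) * u ^ 2)) (fun n => ?_) ?_ (fun n => ?_) ?_
    · exact ((by fun_prop : Continuous fun u => Φ n (u / √n)).measurable.indicator
        measurableSet_Ioc).aestronglyMeasurable
    · exact ((integrable_exp_neg_mul_sq (by positivity)).const_mul 2).integrableOn
    · refine ae_of_all _ fun u => ?_
      by_cases hu : u ∈ Set.Ioc 0 √(n : ℝ)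
      · simp only [F, Set.indicator_of_mem hu]
        have hs : 0 < √(n : ℝ) := hu.1.trans_le hu.2
        have ht : u / √n ∈ Set.Icc (0 : ℝ) 1 :=
          ⟨div_nonneg hu.1.le hs.le, (div_le_one hs).2 hu.2⟩
        have hθ : |u / √n * δ| ≤ δ := by
          rw [abs_of_nonneg (mul_nonneg ht.1 hδ.le)]; exact mul_le_of_le_one_left hδ.le ht.2
        have h := abs_re_exp_mul_discreteCharFun_pow_le (hψ _ hθ) (b n) n
        have e : -(c * n) * (u / √n * δ) ^ 2 = -(c * δ ^ 2) * u ^ 2 := by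
          have hsq : √(n : ℝ) ^ 2 = n := Real.sq_sqrt (by positivity)
          rw [mul_pow, div_pow, hsq]
          have : (n : ℝ) ≠ 0 := by rw [← hsq]; positivity
          field_simp
        rw [e] at h
        rw [norm_mul, Real.norm_eq_abs, Real.norm_eq_abs]
        exact mul_le_mul (hk2 _ ht) h (abs_nonneg _) zero_le_two
      · simp only [F, Set.indicator_of_notMem hu, norm_zero]
        positivity
    · refine (ae_restrict_iff' measurableSet_Ioi).2 (ae_of_all _ fun u (hu : 0 < u) => ?_)
      have hs : Tendsto (fun n : ℕ => √(n : ℝ)) atTop atTop :=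
        Real.tendsto_sqrt_atTop.comp tendsto_natCast_atTop_atTop
      have hev : ∀ᶠ n : ℕ in atTop, Φ n (u / √n) = F n u := by
        filter_upwards [hs.eventually_ge_atTop u] with n hn
        simp only [F, Set.indicator_of_mem (show u ∈ Set.Ioc 0 √(n : ℝ) from ⟨hu, hn⟩)]
      refine Tendsto.congr' hev ?_
      have hk1 : Tendsto (fun n : ℕ => k (u / √n)) atTop (𝓝 1) := by
        have := (hk.tendsto 0).comp (hs.const_div_atTop u)
        simpa [k, Function.comp_def] using this
      have harg : Tendsto (fun n : ℕ => u / √n * δ * b n) atTop (𝓝 (δ * A * u)) := by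
        have h0 : Tendsto (fun n : ℕ => δ * A * u + 5 * u / √n) atTop (𝓝 (δ * A * u + 0)) :=
          tendsto_const_nhds.add (hs.const_div_atTop _)
        rw [add_zero] at h0
        refine h0.congr' ?_
        filter_upwards [hs.eventually_gt_atTop 0] with n hn
        simp only [b]
        field_simp
      have hexp : Tendsto (fun n : ℕ => Complex.exp (-((u / √n * δ : ℝ) * (b n : ℝ)) * Complex.I))
          atTop (𝓝 (Complex.exp (-(δ * A * u : ℝ) * Complex.I))) := by
        have hc : Continuous fun s : ℝ => Complex.exp (-(s : ℂ) * Complex.I) := by fun_prop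
        have := (hc.tendsto (δ * A * u)).comp harg
        refine this.congr fun n => ?_
        simp only [Function.comp_apply]
        push_cast
        rfl
      have hpow : Tendsto (fun n : ℕ => discreteCharFun p X (u / √n * δ) ^ n) atTop
          (𝓝 ((Real.exp (-(σ2 / 2 * δ ^ 2) * u ^ 2) : ℝ) : ℂ)) := by
        have h := tendsto_discreteCharFun_div_sqrt_pow p X hsum hmean (u * δ)
        rw [← hσ2] at h
        have e : -(σ2 / 2 * (u * δ) ^ 2) = -(σ2 / 2 * δ ^ 2) * u ^ 2 := by ring
        rw [e, ← Complex.ofReal_exp] at h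
        refine h.congr fun n => ?_
        rw [div_mul_eq_mul_div]
      have hre := (Complex.continuous_re.tendsto _).comp (hexp.mul hpow)
      rw [Complex.re_mul_ofReal, ← Complex.ofReal_neg, Complex.exp_ofReal_mul_I_re,
        Real.cos_neg] at hre
      rw [← one_mul (Real.cos _ * _)]
      exact hk1.mul hre
  have hJ := integral_cos_mul_gaussian_pos (σ2 / 2 * δ ^ 2) (δ * A) (by positivity)
  set J := ∫ u in Set.Ioi (0 : ℝ), Real.cos (δ * A * u) * Real.exp (-(σ2 / 2 * δ ^ 2) * u ^ 2)
  have hev := (hlim.eventually_const_lt (half_lt_self hJ)).and (eventually_ge_atTop 1)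
  obtain ⟨N, hN⟩ := eventually_atTop.1 hev
  refine ⟨10 / δ, by positivity, J / 4, by positivity, N, fun n hn => ?_⟩
  obtain ⟨h1, h2⟩ := hN n hn
  have hs : 0 < √(n : ℝ) := Real.sqrt_pos.2 (by exact_mod_cast h2)
  rw [← hF n h2] at h1
  have h3 := hupper n
  rw [div_le_iff₀ hs]
  have := mul_le_mul_of_nonneg_left h3 hs.le
  linarith

theorem exists_sum_exp_le_div_sqrt {d : ℕ} (p X : Fin d → ℝ) (hpos : ∀ i, 0 < p i)
    (hsum : ∑ i, p i = 1)
    (hX : ∃ i j, X i ≠ X j) :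
    ∃ K : ℝ, 0 < K ∧ ∀ n : ℕ, 1 ≤ n → ∀ a : ℝ,
      ∑ x : Fin n → Fin d with a ≤ ∑ j, X (x j),
        prodP p x * Real.exp (-(∑ j, X (x j) - a) / 2) ≤ K / √n := by
  obtain ⟨w, hw, K, hK, hconc⟩ := exists_sum_window_le_div_sqrt p X hpos hsum hX
  set r := Real.exp (-w / 2) with hr
  have hr1 : r < 1 := by
    rw [hr, ← Real.exp_zero]; exact Real.exp_lt_exp.2 (by linarith)
  have hr0 : 0 < r := Real.exp_pos _
  have h1r : 0 < 1 - r := by linarith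
  refine ⟨K / (1 - r), by positivity, fun n hn a => ?_⟩
  let G : ℝ → ℝ := fun a => ∑ x : Fin n → Fin d with a ≤ ∑ j, X (x j),
        prodP p x * Real.exp (-(∑ j, X (x j) - a) / 2)
  have hstep : ∀ a, G a ≤ K / √n + r * G (a + w) := fun a => by
    refine le_trans ?_ (add_le_add_left (hconc n hn a) _)
    simp only [G, Finset.sum_filter, Finset.mul_sum, ← Finset.sum_add_distrib]
    refine Finset.sum_le_sum fun x _ => ?_
    have hP := prodP_nonneg hpos x
    have he : r * (prodP p x * Real.exp (-(∑ j, X (x j) - (a + w)) / 2)) =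
        prodP p x * Real.exp (-(∑ j, X (x j) - a) / 2) := by
      rw [mul_left_comm, hr, ← Real.exp_add]; congr 2; ring
    by_cases h1 : a ≤ ∑ j, X (x j)
    · by_cases h2 : a + w ≤ ∑ j, X (x j)
      · rw [if_pos h1, if_pos h2, if_neg (by rintro ⟨_, h⟩; linarith), he, zero_add]
      · rw [if_pos h1, if_neg h2, if_pos ⟨h1, not_le.1 h2⟩, mul_zero, add_zero]
        exact mul_le_of_le_one_right hP (Real.exp_le_one_iff.2 (by linarith))
    · have h2 : ¬a + w ≤ ∑ j, X (x j) := fun h => h1 (by linarith)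
      rw [if_neg h1, if_neg h2, if_neg fun h => h1 h.1, mul_zero, add_zero]
  have hone : ∑ x : Fin n → Fin d, prodP p x = 1 := by
    have := (Finset.prod_univ_sum (fun _ : Fin n => (Finset.univ : Finset (Fin d)))
      (fun _ i => p i))
    simpa [hsum, prodP] using this.symm
  have hG1 : ∀ a, G a ≤ 1 := fun a => by
    rw [← hone]
    simp only [G, Finset.sum_filter]
    refine Finset.sum_le_sum fun x _ => ?_
    have hP := prodP_nonneg hpos x
    split_ifs with h
    · exact mul_le_of_le_one_right hP (Real.exp_le_one_iff.2 (by linarith))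
    · exact hP
  have hiter : ∀ m : ℕ, ∀ a, G a ≤ K / (1 - r) / √n + r ^ m := fun m => by
    induction m with
    | zero =>
      intro a
      have : 0 ≤ K / (1 - r) / √n := by positivity
      simpa using (hG1 a).trans (by linarith)
    | succ m ih =>
      intro a
      refine (hstep a).trans ?_
      have h := mul_le_mul_of_nonneg_left (ih (a + w)) hr0.le
      have e : K / √n + r * (K / (1 - r) / √n + r ^ m) = K / (1 - r) / √n + r ^ (m + 1) := by
        field_simp
        ring
      linarith
  have hl : Tendsto (fun m : ℕ => K / (1 - r) / √n + r ^ m) atTop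
      (𝓝 (K / (1 - r) / √n + 0)) :=
    tendsto_const_nhds.add (tendsto_pow_atTop_nhds_zero_of_lt_one hr0.le hr1)
  rw [add_zero] at hl
  exact ge_of_tendsto' hl fun m => hiter m a

theorem PnHalf_eq {d : ℕ} (p : Fin d → ℝ) (hpos : ∀ i, 0 < p i) (A : ℝ) (n : ℕ) (hn : 1 ≤ n) :
    PnHalf d p n (-shannonH p + A / √n) =
      Real.exp (n * shannonH p / 2 - √n * A / 2) *
      ∑ x : Fin n → Fin d with A * √n ≤ ∑ j, (Real.log (p (x j)) + shannonH p),
        prodP p x * Real.exp (-(∑ j, (Real.log (p (x j)) + shannonH p) - A * √n) / 2) := by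
  have hs : 0 < √(n : ℝ) := Real.sqrt_pos.2 (by exact_mod_cast hn)
  have hlog : ∀ x : Fin n → Fin d, ∑ j, (Real.log (p (x j)) + shannonH p) =
      Real.log (prodP p x) + n * shannonH p := fun x => by
    rw [prodP, Real.log_prod fun j _ => (hpos _).ne', Finset.sum_add_distrib]
    simp
  have hR : (n : ℝ) * (-shannonH p + A / √n) = A * √n - n * shannonH p := by
    have : (n : ℝ) / √n = √n := Real.div_sqrt
    rw [mul_add, mul_div_left_comm, this]; ring
  unfold PnHalf SnSet
  rw [Finset.mul_sum, hR]
  simp_rw [hlog]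
  refine Finset.sum_congr (Finset.filter_congr fun x _ => sub_le_iff_le_add) fun x _ => ?_
  have hP : 0 < prodP p x := Finset.prod_pos fun _ _ => hpos _
  rw [mul_left_comm, ← Real.exp_add]
  have e : n * shannonH p / 2 - √n * A / 2 +
      -(Real.log (prodP p x) + n * shannonH p - A * √n) / 2 = -(Real.log (prodP p x) / 2) := by ring
  rw [e, Real.exp_neg, ← Real.log_sqrt hP.le, Real.exp_log (Real.sqrt_pos.2 hP),
    ← div_eq_mul_inv, Real.div_sqrt]

theorem stmt19 {d : ℕ} (p : Fin d → ℝ)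
    (hpos : ∀ i, 0 < p i) (hsum : ∑ i, p i = 1)
    (hnonunif : ∃ i j, p i ≠ p j) (A : ℝ) :
    ∃ (C : ℝ) (N : ℕ), ∀ n ≥ N,
      |Real.log (PnHalf d p n (-shannonH p + A / Real.sqrt n)) -
        ((n : ℝ) * shannonH p / 2 - Real.sqrt n * A / 2 - (1 / 2) * Real.log n)| ≤ C := by
  let X : Fin d → ℝ := fun i => Real.log (p i) + shannonH p
  have hX : ∃ i j, X i ≠ X j := by
    obtain ⟨i, j, hij⟩ := hnonunif
    refine ⟨i, j, fun h => hij (Real.log_injOn_pos (hpos i) (hpos j) ?_)⟩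
    simpa [X] using h
  have hmean : ∑ i, p i * X i = 0 := by
    simp only [X, mul_add, Finset.sum_add_distrib, ← Finset.sum_mul, hsum]
    rw [shannonH]; ring
  obtain ⟨K, hK, hup⟩ := exists_sum_exp_le_div_sqrt p X hpos hsum hX
  obtain ⟨L, hL, k, hk, N, hlow⟩ := exists_div_sqrt_le_sum_window p X hpos hsum hmean hX A
  refine ⟨|Real.log K| + |Real.log (Real.exp (-L / 2) * k)|, max N 1, fun n hn => ?_⟩
  have hn1 : 1 ≤ n := (le_max_right _ _).trans hn
  have hs : 0 < √(n : ℝ) := Real.sqrt_pos.2 (by exact_mod_cast hn1)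
  have hU := hup n hn1 (A * √n)
  have hLow := hlow n ((le_max_left _ _).trans hn)
  rw [PnHalf_eq p hpos A n hn1]
  set S := ∑ x : Fin n → Fin d with A * √n ≤ ∑ j, X (x j),
        prodP p x * Real.exp (-(∑ j, X (x j) - A * √n) / 2) with hS
  have hSlow : Real.exp (-L / 2) * k / √n ≤ S := by
    rw [mul_div_assoc]
    refine (mul_le_mul_of_nonneg_left hLow (Real.exp_pos _).le).trans ?_
    rw [hS, Finset.sum_filter, Finset.sum_filter, Finset.mul_sum]
    refine Finset.sum_le_sum fun x _ => ?_
    have hP := prodP_nonneg hpos x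
    by_cases h1 : A * √n ≤ ∑ j, X (x j)
    · rw [if_pos h1]
      split_ifs with h2
      · rw [mul_comm]
        exact mul_le_mul_of_nonneg_left (Real.exp_le_exp.2 (by linarith [h2.2])) hP
      · rw [mul_zero]; exact mul_nonneg hP (Real.exp_pos _).le
    · rw [if_neg h1, if_neg fun h => h1 h.1, mul_zero]
  have hk' : 0 < Real.exp (-L / 2) * k := mul_pos (Real.exp_pos _) hk
  have hSpos : 0 < S := (div_pos hk' hs).trans_le hSlow
  have h1 := Real.log_le_log (div_pos hk' hs) hSlow
  have h2 := Real.log_le_log hSpos hU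
  rw [Real.log_div hk'.ne' hs.ne', Real.log_sqrt (Nat.cast_nonneg n)] at h1
  rw [Real.log_div hK.ne' hs.ne', Real.log_sqrt (Nat.cast_nonneg n)] at h2
  have e : Real.log (Real.exp (n * shannonH p / 2 - √n * A / 2) * S) =
      n * shannonH p / 2 - √n * A / 2 + Real.log S := by
    rw [Real.log_mul (Real.exp_pos _).ne' hSpos.ne', Real.log_exp]
  refine (congrArg (fun y => |y - _|) e).trans_le ?_
  rw [abs_le]
  have := le_abs_self (Real.log K)
  have := neg_abs_le (Real.log (Real.exp (-L / 2) * k))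
  have := abs_nonneg (Real.log K)
  have := abs_nonneg (Real.log (Real.exp (-L / 2) * k))
  constructor <;> linarith
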